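/- For every λ = (λ1,λ2) ∈ ℕ₀², one has P_λ(0,t) = P^{SU(2)}_{λ1}(t) in ℤ[t] and P_λ(s,0) = P^{SU(2)}_{λ2}(s) in ℤ[s]. -/

import Mathlib

open MvPolynomial

noncomputable section

abbrev Rxy : Type := MvPolynomial (Fin 2) ℤ

/-- The fraction field of ℤ[x,y]. -/
abbrev Kxy : Type := FractionRing Rxy

/-- The image of `x` in the fraction field. -/
noncomputable def xx : Kxy := algebraMap Rxy Kxy (X 0)

/-- The image of `y` in the fraction field. -/
noncomputable def yy : Kxy := algebraMap Rxy Kxy (X 1)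

/-- `s = x / y²`. -/
noncomputable def sv : Kxy := xx / yy ^ 2

/-- `t = y / x²`. -/
noncomputable def tv : Kxy := yy / xx ^ 2

/-- Evaluation of a two-variable integer polynomial at `(s, t)` in the fraction field. -/
noncomputable def evST (p : Rxy) : Kxy := aeval ![sv, tv] p

/-- Defining properties of the SU(3) character polynomials `Q a b`
(with the convention `Q a b = 0` whenever `(a, b) ∉ ℕ₀²`). -/
def IsQSU3 (Q : ℤ → ℤ → Rxy) : Prop :=
  (∀ a b : ℤ, (a < 0 ∨ b < 0) → Q a b = 0) ∧
  Q 0 0 = 1 ∧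
  Q 1 0 = X 0 ∧
  (∀ a b : ℤ, 0 ≤ a → 0 ≤ b →
    X 0 * Q a b = Q (a + 1) b + Q a (b - 1) + Q (a - 1) (b + 1)) ∧
  (∀ a b : ℤ, rename (Equiv.swap (0 : Fin 2) 1) (Q a b) = Q b a)

/-- Defining property of the polynomials `P a b` (in the variables `s, t`), namely
`P_λ(x/y², y/x²) = x^{-λ₁} y^{-λ₂} Q_λ(x,y)` in the fraction field of ℤ[x,y]
(with the convention `P a b = 0` whenever `(a, b) ∉ ℕ₀²`). -/
def IsPSU3 (Q P : ℤ → ℤ → Rxy) : Prop :=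
  (∀ a b : ℤ, (a < 0 ∨ b < 0) → P a b = 0) ∧
  (∀ a b : ℤ, 0 ≤ a → 0 ≤ b →
    evST (P a b) = algebraMap Rxy Kxy (Q a b) / (xx ^ a * yy ^ b))

/-- Defining properties of the SU(2) polynomials `P^{SU(2)}_n(t)`:
`P_0 = P_1 = 1` and `P_{n+1} = P_n - t·P_{n-1}` for `n ≥ 1`. -/
def IsPSU2 (S : ℕ → Polynomial ℤ) : Prop :=
  S 0 = 1 ∧ S 1 = 1 ∧ ∀ n : ℕ, 1 ≤ n → S (n + 1) = S n - Polynomial.X * S (n - 1)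

lemma xx_ne : xx ≠ 0 := by
  unfold xx
  rw [Ne, FaithfulSMul.algebraMap_eq_zero_iff]
  exact X_ne_zero 0

lemma yy_ne : yy ≠ 0 := by
  unfold yy
  rw [Ne, FaithfulSMul.algebraMap_eq_zero_iff]
  exact X_ne_zero 1

/-- The exponent vector of `(xy)^(2N) s^i t^j`. -/
def expo (N : ℕ) (m : Fin 2 →₀ ℕ) : Fin 2 →₀ ℕ :=
  Finsupp.single 0 (2 * N + m 0 - 2 * m 1) + Finsupp.single 1 (2 * N + m 1 - 2 * m 0)

lemma alg_monomial (u v : ℕ) (c : ℤ) :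
    algebraMap Rxy Kxy (monomial (Finsupp.single 0 u + Finsupp.single 1 v) c)
      = (c : Kxy) * (xx ^ u * yy ^ v) := by
  have : (monomial (Finsupp.single 0 u + Finsupp.single 1 v) c : Rxy)
      = C c * (X 0 ^ u * X 1 ^ v) := by
    rw [X_pow_eq_monomial, X_pow_eq_monomial, monomial_mul, C_mul_monomial]
    simp
  rw [this, map_mul, map_mul, map_pow, map_pow]
  simp [xx, yy]

lemma evST_inj (p : Rxy) (h : evST p = 0) : p = 0 := by
  classical
  obtain ⟨N, hN⟩ : ∃ N : ℕ, ∀ m ∈ p.support, m 0 ≤ N ∧ m 1 ≤ N := by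
    refine ⟨p.totalDegree, fun m hm => ?_⟩
    have := le_totalDegree hm
    rw [Finsupp.sum_fintype _ _ (by simp), Fin.sum_univ_two] at this
    omega
  set q : Rxy := ∑ m ∈ p.support, monomial (expo N m) (coeff m p) with hq
  have hx := xx_ne
  have hy := yy_ne
  have hq0 : algebraMap Rxy Kxy q = (xx * yy) ^ (2 * N) * evST p := by
    rw [hq, map_sum, evST, aeval_def, eval₂_eq', Finset.mul_sum]
    refine Finset.sum_congr rfl fun m hm => ?_
    obtain ⟨h0, h1⟩ := hN m hm
    rw [expo, alg_monomial, Fin.prod_univ_two]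
    simp only [algebraMap_int_eq, eq_intCast, Matrix.cons_val_zero, Matrix.cons_val_one, sv, tv]
    obtain ⟨u, hu⟩ : ∃ u, 2 * N + m 0 = u + 2 * m 1 := ⟨2 * N + m 0 - 2 * m 1, by omega⟩
    obtain ⟨v, hv⟩ : ∃ v, 2 * N + m 1 = v + 2 * m 0 := ⟨2 * N + m 1 - 2 * m 0, by omega⟩
    rw [hu, hv, Nat.add_sub_cancel, Nat.add_sub_cancel]
    have e1 : xx ^ (2 * N) * xx ^ (m 0) = xx ^ u * (xx ^ 2) ^ (m 1) := by
      rw [← pow_add, hu, pow_add, pow_mul]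
    have e2 : yy ^ (2 * N) * yy ^ (m 1) = yy ^ v * (yy ^ 2) ^ (m 0) := by
      rw [← pow_add, hv, pow_add, pow_mul]
    rw [div_pow, div_pow, mul_pow, div_mul_div_comm]
    have hd : (yy ^ 2) ^ m 0 * (xx ^ 2) ^ m 1 ≠ 0 := by positivity
    rw [← mul_div_assoc, ← mul_div_assoc, eq_div_iff hd]
    linear_combination (-((coeff m p : ℤ) : Kxy)) * yy ^ (2 * N) * yy ^ (m 1) * e1
      - ((coeff m p : ℤ) : Kxy) * xx ^ u * (xx ^ 2) ^ (m 1) * e2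
  rw [h, mul_zero, FaithfulSMul.algebraMap_eq_zero_iff] at hq0
  ext m
  rw [coeff_zero]
  by_contra hm
  have hms : m ∈ p.support := mem_support_iff.2 hm
  have hc : coeff (expo N m) q = coeff m p := by
    rw [hq, coeff_sum, Finset.sum_eq_single m]
    · simp
    · intro m' hm' hne
      rw [coeff_monomial, if_neg]
      intro he
      apply hne
      have a0 := DFunLike.congr_fun he 0
      have a1 := DFunLike.congr_fun he 1
      have := hN m hms
      have := hN m' hm'
      simp [expo] at a0 a1
      ext i
      fin_cases i <;> simp <;> omega
    · intro h'; exact absurd hms h'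
  rw [hq0, coeff_zero] at hc
  exact hm hc.symm

section
variable {Q P : ℤ → ℤ → Rxy}

lemma evP (hQ : IsQSU3 Q) (hP : IsPSU3 Q P) (a b : ℤ) :
    evST (P a b) = algebraMap Rxy Kxy (Q a b) / (xx ^ a * yy ^ b) := by
  by_cases h : a < 0 ∨ b < 0
  · rw [hP.1 a b h, hQ.1 a b h]; simp [evST]
  · push Not at h
    exact hP.2 a b h.1 h.2

lemma evQ (hQ : IsQSU3 Q) (hP : IsPSU3 Q P) (a b : ℤ) :
    algebraMap Rxy Kxy (Q a b) = evST (P a b) * (xx ^ a * yy ^ b) := by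
  have hx := xx_ne
  have hy := yy_ne
  rw [evP hQ hP, div_mul_cancel₀]
  exact mul_ne_zero (zpow_ne_zero _ hx) (zpow_ne_zero _ hy)

lemma recP1 (hQ : IsQSU3 Q) (hP : IsPSU3 Q P) (a b : ℤ) (ha : 0 ≤ a) (hb : 0 ≤ b) :
    P (a + 1) b = P a b - X 0 * X 1 * P a (b - 1) - X 1 * P (a - 1) (b + 1) := by
  have hx := xx_ne
  have hy := yy_ne
  rw [← sub_eq_zero]
  apply evST_inj
  have h := congrArg (algebraMap Rxy Kxy) (hQ.2.2.2.1 a b ha hb)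
  rw [map_mul, map_add, map_add, evQ hQ hP, evQ hQ hP, evQ hQ hP, evQ hQ hP] at h
  change xx * _ = _ at h
  have e : evST (P (a + 1) b - (P a b - X 0 * X 1 * P a (b - 1) - X 1 * P (a - 1) (b + 1)))
    = evST (P (a + 1) b) - (evST (P a b) - sv * tv * evST (P a (b - 1))
      - tv * evST (P (a - 1) (b + 1))) := by simp [evST]
  rw [e]
  generalize evST (P (a + 1) b) = A at *
  generalize evST (P a b) = B at *
  generalize evST (P a (b - 1)) = D at *
  generalize evST (P (a - 1) (b + 1)) = E at *
  rw [zpow_add_one₀ hx, zpow_add_one₀ hy, zpow_sub_one₀ hx, zpow_sub_one₀ hy] at h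
  have hxa := zpow_ne_zero a hx
  have hyb := zpow_ne_zero b hy
  generalize xx ^ a = U at *
  generalize yy ^ b = V at *
  have h2 : U * V * xx * (A - (B - sv * tv * D - tv * E)) = 0 := by
    have e1 : sv * tv = xx⁻¹ * yy⁻¹ := by unfold sv tv; field_simp
    have e2 : tv = xx⁻¹ * xx⁻¹ * yy := by unfold tv; field_simp
    rw [e1, e2]
    have e3 : xx * xx⁻¹ = 1 := mul_inv_cancel₀ hx
    linear_combination -h + U * V * (D * yy⁻¹ + E * xx⁻¹ * yy) * e3
  exact (mul_eq_zero.1 h2).resolve_left (mul_ne_zero (mul_ne_zero hxa hyb) hx)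

lemma recP2 (hQ : IsQSU3 Q) (hP : IsPSU3 Q P) (a b : ℤ) (ha : 0 ≤ a) (hb : 0 ≤ b) :
    P a (b + 1) = P a b - X 0 * X 1 * P (a - 1) b - X 0 * P (a + 1) (b - 1) := by
  have hx := xx_ne
  have hy := yy_ne
  rw [← sub_eq_zero]
  apply evST_inj
  have h0 := congrArg (rename (Equiv.swap (0 : Fin 2) 1)) (hQ.2.2.2.1 b a hb ha)
  rw [map_mul, map_add, map_add, hQ.2.2.2.2, hQ.2.2.2.2, hQ.2.2.2.2, hQ.2.2.2.2, rename_X,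
    Equiv.swap_apply_left] at h0
  have h := congrArg (algebraMap Rxy Kxy) h0
  rw [map_mul, map_add, map_add, evQ hQ hP, evQ hQ hP, evQ hQ hP, evQ hQ hP] at h
  change yy * _ = _ at h
  have e : evST (P a (b + 1) - (P a b - X 0 * X 1 * P (a - 1) b - X 0 * P (a + 1) (b - 1)))
    = evST (P a (b + 1)) - (evST (P a b) - sv * tv * evST (P (a - 1) b)
      - sv * evST (P (a + 1) (b - 1))) := by simp [evST]
  rw [e]
  generalize evST (P a (b + 1)) = A at *
  generalize evST (P a b) = B at *
  generalize evST (P (a - 1) b) = D at *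
  generalize evST (P (a + 1) (b - 1)) = E at *
  rw [zpow_add_one₀ hx, zpow_add_one₀ hy, zpow_sub_one₀ hx, zpow_sub_one₀ hy] at h
  have hxa := zpow_ne_zero a hx
  have hyb := zpow_ne_zero b hy
  generalize xx ^ a = U at *
  generalize yy ^ b = V at *
  have h2 : U * V * yy * (A - (B - sv * tv * D - sv * E)) = 0 := by
    have e1 : sv * tv = xx⁻¹ * yy⁻¹ := by unfold sv tv; field_simp
    have e2 : sv = yy⁻¹ * yy⁻¹ * xx := by unfold sv; field_simp
    rw [e1, e2]
    have e3 : yy * yy⁻¹ = 1 := mul_inv_cancel₀ hy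
    linear_combination -h + U * V * (D * xx⁻¹ + E * yy⁻¹ * xx) * e3
  exact (mul_eq_zero.1 h2).resolve_left (mul_ne_zero (mul_ne_zero hxa hyb) hy)

lemma P00 (hQ : IsQSU3 Q) (hP : IsPSU3 Q P) : P 0 0 = 1 := by
  rw [← sub_eq_zero]
  apply evST_inj
  have h := evP hQ hP 0 0
  rw [hQ.2.1] at h
  have e : evST (P 0 0 - 1) = evST (P 0 0) - 1 := by simp [evST]
  rw [e, h]; simp

end

/-- A sequence satisfying the SU(2) recursion is `S`. -/
lemma S_unique (S : ℕ → Polynomial ℤ) (hS : IsPSU2 S) (f : ℤ → Polynomial ℤ)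
    (f0 : f 0 = 1) (fm : f (-1) = 0)
    (hf : ∀ n : ℕ, f (n + 1) = f n - Polynomial.X * f (n - 1)) (n : ℕ) :
    f n = S n ∧ f (n + 1) = S (n + 1) := by
  induction n with
  | zero =>
    have := hf 0
    simp [f0, fm] at this
    simp [hS.1, hS.2.1, f0, this]
  | succ k ih =>
    refine ⟨by exact_mod_cast ih.2, ?_⟩
    have h1 := hf (k + 1)
    rw [hS.2.2 (k + 1) (by omega), h1]
    push_cast
    rw [ih.2, add_sub_cancel_right, ih.1]

theorem stmt_4 (Q P : ℤ → ℤ → Rxy) (hQ : IsQSU3 Q) (hP : IsPSU3 Q P)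
    (S : ℕ → Polynomial ℤ) (hS : IsPSU2 S) (l1 l2 : ℕ) :
    aeval ![(0 : Polynomial ℤ), Polynomial.X] (P (l1 : ℤ) (l2 : ℤ)) = S l1 ∧
    aeval ![Polynomial.X, (0 : Polynomial ℤ)] (P (l1 : ℤ) (l2 : ℤ)) = S l2 := by
  constructor
  · set F := aeval (R := ℤ) ![(0 : Polynomial ℤ), Polynomial.X] with hF
    have r2 : ∀ (a : ℤ) (b : ℕ), F (P a b) = F (P a 0) := by
      intro a b
      by_cases ha : a < 0
      · rw [hP.1 _ _ (Or.inl ha), hP.1 _ _ (Or.inl ha)]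
      induction b with
      | zero => simp
      | succ k ih =>
        push_cast
        rw [recP2 hQ hP a k (by omega) (by omega), ← ih]
        simp [hF]
    rw [r2]
    refine (S_unique S hS (fun a => F (P a 0)) ?_ ?_ ?_ l1).1
    · simp [P00 hQ hP]
    · simp [hP.1 (-1) 0 (by simp)]
    · intro n
      have h := r2 (n - 1) 1
      push_cast at h
      rw [recP1 hQ hP n 0 (by omega) le_rfl, ← h]
      simp [hF]
  · set F := aeval (R := ℤ) ![Polynomial.X, (0 : Polynomial ℤ)] with hF
    have r2 : ∀ (b : ℤ) (a : ℕ), F (P a b) = F (P 0 b) := by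
      intro b a
      by_cases hb : b < 0
      · rw [hP.1 _ _ (Or.inr hb), hP.1 _ _ (Or.inr hb)]
      induction a with
      | zero => simp
      | succ k ih =>
        push_cast
        rw [recP1 hQ hP k b (by omega) (by omega), ← ih]
        simp [hF]
    rw [r2]
    refine (S_unique S hS (fun b => F (P 0 b)) ?_ ?_ ?_ l2).1
    · simp [P00 hQ hP]
    · simp [hP.1 0 (-1) (by simp)]
    · intro n
      have h := r2 (n - 1) 1
      push_cast at h
      rw [recP2 hQ hP 0 n le_rfl (by omega), ← h]
      simp [hF]
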